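/- (ν-weighted gradient control by fractional dissipation.) Let 0 < s < 1, let max{−3, −3/2 − 2s} < γ < −2s, and set κ := 1/(1+2s), so that s(1−κ) + (1−s)(1+κ) = 2κ. There exists a constant C = C(s, γ) > 0 such that for every ν ∈ (0,1], every A₀ ≥ 1, and every f ∈ C_c^∞(ℝ³; ℝ), ν^{2κ} ‖∇_v f‖²_{L²(ℝ³)} ≤ C A₀^{−s} ( A₀ ν^{1−κ} [⟨v⟩^{−γ(1−s)/(2s)} f]²_{Ḣ^s} )^{s} ( ν^{1+κ} [⟨v⟩^{γ/2} ∇_v f]²_{Ḣ^s} )^{1−s} ≤ C A₀^{−s} ( A₀ ν^{1−κ} [⟨v⟩^{−γ(1−s)/(2s)} f]²_{Ḣ^s} + ν^{1+κ} [⟨v⟩^{γ/2} ∇_v f]²_{Ḣ^s} ). -/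

import Mathlib

open MeasureTheory Real

noncomputable section

/-- ℝ³ as a Euclidean space. -/
abbrev E3 := EuclideanSpace ℝ (Fin 3)

/-- Japanese bracket `⟨v⟩ = √(1 + |v|²)`. -/
def jap (v : E3) : ℝ := Real.sqrt (1 + ‖v‖ ^ 2)

/-- The `j`-th partial derivative of `f : ℝ³ → ℝ`. -/
def pd (f : E3 → ℝ) (j : Fin 3) (v : E3) : ℝ :=
  fderiv ℝ f v (EuclideanSpace.single j 1)

/-- Square of the homogeneous Gagliardo fractional Sobolev seminorm `[g]_{Ḣ^s}²`. -/
def gagSq (s : ℝ) (g : E3 → ℝ) : ℝ :=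
  ∫ v : E3, ∫ w : E3, (g v - g w) ^ 2 / ‖v - w‖ ^ (3 + 2 * s)

lemma jap_one_le (v : E3) : 1 ≤ jap v := by
  unfold jap
  rw [Real.one_le_sqrt]
  nlinarith [sq_nonneg ‖v‖]

lemma jap_pos (v : E3) : 0 < jap v := lt_of_lt_of_le one_pos (jap_one_le v)

lemma jap_sq (v : E3) : jap v ^ 2 = 1 + ‖v‖ ^ 2 := by
  unfold jap
  rw [Real.sq_sqrt (by positivity)]

lemma norm_le_jap (v : E3) : ‖v‖ ≤ jap v := by
  apply (sq_le_sq₀ (norm_nonneg v) (jap_pos v).le).1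
  rw [jap_sq]; linarith

lemma jap_sub_le (v w : E3) : |jap v - jap w| ≤ ‖v - w‖ := by
  have h1 := abs_norm_sub_norm_le v w
  refine le_trans ?_ h1
  apply sq_le_sq.1
  have hv := jap_sq v
  have hw := jap_sq w
  have : 1 + ‖v‖ * ‖w‖ ≤ jap v * jap w := by
    apply (sq_le_sq₀ (by positivity) (mul_pos (jap_pos v) (jap_pos w)).le).1
    rw [mul_pow, hv, hw]
    nlinarith [sq_nonneg (‖v‖ - ‖w‖)]
  nlinarith

lemma jap_contDiff : ContDiff ℝ (⊤ : ℕ∞) jap := by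
  unfold jap
  apply ContDiff.sqrt
  · exact contDiff_const.add (contDiff_norm_sq ℝ)
  · intro v; positivity

lemma jap_continuous : Continuous jap := jap_contDiff.continuous

lemma jap_rpow_contDiff (p : ℝ) : ContDiff ℝ (⊤ : ℕ∞) (fun v => jap v ^ p) :=
  jap_contDiff.rpow_const_of_ne (fun v => (jap_pos v).ne')

lemma pd_contDiff {f : E3 → ℝ} (hf : ContDiff ℝ (⊤ : ℕ∞) f) (j : Fin 3) :
    ContDiff ℝ (⊤ : ℕ∞) (pd f j) := by
  have : ContDiff ℝ (⊤ : ℕ∞) (fderiv ℝ f) := hf.fderiv_right (by simp)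
  exact this.clm_apply contDiff_const

lemma pd_hasCompactSupport {f : E3 → ℝ} (hf : HasCompactSupport f) (j : Fin 3) :
    HasCompactSupport (pd f j) := by
  have := hf.fderiv (𝕜 := ℝ)
  exact this.comp_left (g := fun L : E3 →L[ℝ] ℝ => L (EuclideanSpace.single j 1)) (by simp)

lemma radial_integrable {s : ℝ} (hs0 : 0 < s) (hs1 : s < 1) :
    Integrable (fun z : E3 => min (‖z‖ ^ 2) 1 / ‖z‖ ^ (3 + 2 * s)) := by
  have := integrable_fun_norm_addHaar (volume : Measure E3)
    (f := fun y : ℝ => min (y ^ 2) 1 / y ^ (3 + 2 * s))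
  rw [this]
  have hd : Module.finrank ℝ E3 = 3 := by simp
  rw [hd, ← Set.Ioo_union_Ici_eq_Ioi (zero_lt_one : (0:ℝ) < 1)]
  apply IntegrableOn.union
  · have h := (intervalIntegral.integrableOn_Ioo_rpow_iff (s := 1 - 2 * s)
      (zero_lt_one : (0:ℝ) < 1)).2 (by linarith)
    refine h.congr_fun (fun y hy => ?_) measurableSet_Ioo
    have h0 : 0 < y := hy.1
    have h1 : y ^ 2 ≤ 1 := by nlinarith [hy.2, hy.1]
    simp only [min_eq_left h1, smul_eq_mul]
    rw [← mul_div_assoc, ← pow_add, eq_div_iff (by positivity), ← Real.rpow_add h0,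
      ← Real.rpow_natCast]
    norm_num
  · rw [integrableOn_Ici_iff_integrableOn_Ioi]
    have h := integrableOn_Ioi_rpow_of_lt (a := -1 - 2 * s) (c := 1) (by linarith) one_pos
    refine h.congr_fun (fun y hy => ?_) measurableSet_Ioi
    have h1 : 1 < y := hy
    have h0 : 0 < y := by linarith
    have h1 : 1 ≤ y ^ 2 := by nlinarith
    simp only [min_eq_right h1, smul_eq_mul]
    rw [← mul_div_assoc, eq_div_iff (by positivity), ← Real.rpow_add h0,
      ← Real.rpow_natCast]
    norm_num

lemma kernel_integrable {s : ℝ} (hs0 : 0 < s) (hs1 : s < 1) {G : E3 → ℝ}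
    (hG : ContDiff ℝ (⊤ : ℕ∞) G) (hc : HasCompactSupport G) :
    Integrable (fun p : E3 × E3 => (G p.1 - G p.2) ^ 2 / ‖p.1 - p.2‖ ^ (3 + 2 * s))
      ((volume : Measure E3).prod volume) := by
  obtain ⟨L, hL⟩ := ContDiff.lipschitzWith_of_hasCompactSupport hc hG (by simp)
  obtain ⟨M, hM⟩ := hc.exists_bound_of_continuous hG.continuous
  set K := tsupport G
  have hK : IsCompact K := hc
  have h1 : Integrable (K.indicator (fun _ => (1:ℝ))) (volume : Measure E3) := by
    rw [integrable_indicator_iff hK.measurableSet]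
    exact integrableOn_const hK.measure_lt_top.ne
  have hm := radial_integrable hs0 hs1
  have hA := Integrable.convolution_integrand (ContinuousLinearMap.mul ℝ ℝ) h1 hm
  have hB := hA.swap
  simp only [ContinuousLinearMap.mul_apply', Function.comp_def, Prod.fst_swap,
    Prod.snd_swap] at hA hB
  refine ((hA.add hB).const_mul ((L:ℝ) ^ 2 + 4 * M ^ 2)).mono' ?_ ?_
  · have hGc := hG.continuous
    apply Measurable.aestronglyMeasurable
    apply Measurable.div
    · exact (((hGc.comp continuous_fst).sub (hGc.comp continuous_snd)).pow 2).measurable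
    · exact (continuous_fst.sub continuous_snd).norm.measurable.pow_const _
  · refine Filter.Eventually.of_forall ?_
    rintro ⟨v, w⟩
    simp only [Pi.add_apply]
    rw [norm_sub_rev w v, Real.norm_of_nonneg (by positivity), ← add_mul, ← mul_assoc,
      ← mul_div_assoc]
    apply div_le_div_of_nonneg_right _ (by positivity)
    have hmin : 0 ≤ min (‖v - w‖ ^ 2) 1 := by positivity
    by_cases hv : v ∈ K ∨ w ∈ K
    · have hi : 1 ≤ K.indicator (fun _ => (1:ℝ)) w + K.indicator (fun _ => (1:ℝ)) v := by
        have hn : ∀ x, 0 ≤ K.indicator (fun _ => (1:ℝ)) x := fun x =>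
          Set.indicator_nonneg (fun _ _ => zero_le_one) x
        rcases hv with hv | hv
        · have := hn w
          rw [Set.indicator_of_mem hv]; linarith
        · have := hn v
          rw [Set.indicator_of_mem hv]; linarith
      have hq : (G v - G w) ^ 2 ≤ ((L:ℝ) ^ 2 + 4 * M ^ 2) * min (‖v - w‖ ^ 2) 1 := by
        have q1 : (G v - G w) ^ 2 ≤ (L:ℝ) ^ 2 * ‖v - w‖ ^ 2 := by
          have := hL.dist_le_mul v w
          rw [Real.dist_eq, dist_eq_norm] at this
          rw [← mul_pow, ← sq_abs]
          gcongr
        have q2 : (G v - G w) ^ 2 ≤ 4 * M ^ 2 := by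
          have a := abs_le.1 (hM v)
          have b := abs_le.1 (hM w)
          have : |G v - G w| ≤ 2 * M := by
            rw [abs_le]; constructor <;> linarith
          have := pow_le_pow_left₀ (abs_nonneg _) this 2
          rw [sq_abs] at this
          linarith
        rcases min_cases (‖v - w‖ ^ 2) 1 with ⟨h, _⟩ | ⟨h, _⟩ <;> rw [h]
        · nlinarith [sq_nonneg M, sq_nonneg ‖v - w‖, mul_nonneg (sq_nonneg M) (sq_nonneg ‖v - w‖)]
        · nlinarith [sq_nonneg (L:ℝ)]
      have hc0 : 0 ≤ ((L:ℝ) ^ 2 + 4 * M ^ 2) := by positivity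
      calc _ ≤ _ := hq
        _ = ((L:ℝ) ^ 2 + 4 * M ^ 2) * 1 * min (‖v - w‖ ^ 2) 1 := by ring
        _ ≤ _ := by gcongr
    · push Not at hv
      have e1 : G v = 0 := image_eq_zero_of_notMem_tsupport hv.1
      have e2 : G w = 0 := image_eq_zero_of_notMem_tsupport hv.2
      rw [Set.indicator_of_notMem hv.1, Set.indicator_of_notMem hv.2, e1, e2]
      simp

lemma weight_scalar (p : ℝ) : ∃ C > 0, ∀ x y : ℝ, 0 < x → |y - x| ≤ x / 2 →
    |y ^ p - x ^ p| ≤ C * x ^ p * (|y - x| / x) ∧ y ^ p ≤ C * x ^ p := by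
  have hcd : ContDiffOn ℝ 1 (fun t : ℝ => t ^ p) (Set.Icc (1/2) (3/2)) := by
    intro t ht
    exact (Real.contDiffAt_rpow_const_of_ne (by linarith [ht.1] : t ≠ 0)).contDiffWithinAt
  obtain ⟨K, hK⟩ := hcd.exists_lipschitzOnWith (by simp) (convex_Icc _ _) isCompact_Icc
  refine ⟨K + 1, by positivity, fun x y hx hxy => ?_⟩
  have hab := abs_le.1 hxy
  have hy : 0 < y := by linarith
  have ht : y / x ∈ Set.Icc (1/2 : ℝ) (3/2) := by
    constructor
    · rw [le_div_iff₀ hx]; linarith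
    · rw [div_le_iff₀ hx]; linarith
  have h := hK.dist_le_mul _ ht 1 (by norm_num)
  rw [Real.dist_eq, Real.dist_eq, Real.one_rpow, Real.div_rpow hy.le hx.le] at h
  have hxp : 0 < x ^ p := by positivity
  have e1 : y ^ p / x ^ p - 1 = (y ^ p - x ^ p) / x ^ p := by field_simp
  have e2 : y / x - 1 = (y - x) / x := by field_simp
  rw [e1, e2, abs_div, abs_div, abs_of_pos hx, abs_of_pos hxp, div_le_iff₀ hxp] at h
  have hd : 0 ≤ |y - x| / x := by positivity
  have hd2 : |y - x| / x ≤ 1 := by rw [div_le_one hx]; linarith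
  have hK0 : (0:ℝ) ≤ K := K.2
  have key : |y ^ p - x ^ p| ≤ K * x ^ p * (|y - x| / x) := by linarith
  constructor
  · refine key.trans ?_
    gcongr; linarith
  · have := le_abs_self (y ^ p - x ^ p)
    have h3 : K * x ^ p * (|y - x| / x) ≤ K * x ^ p * 1 := by gcongr
    nlinarith

/-- The inner Gagliardo integral. -/
def gagD (s : ℝ) (G : E3 → ℝ) (v : E3) : ℝ :=
  ∫ w : E3, (G v - G w) ^ 2 / ‖v - w‖ ^ (3 + 2 * s)

lemma vol_real_closedBall (v : E3) {r : ℝ} (hr : 0 ≤ r) :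
    (volume : Measure E3).real (Metric.closedBall v r)
      = r ^ 3 * (volume : Measure E3).real (Metric.ball 0 1) := by
  rw [Measure.addHaar_real_closedBall _ _ hr]
  simp

lemma vol_unit_pos : 0 < (volume : Measure E3).real (Metric.ball 0 1) := by
  rw [Measure.real, ENNReal.toReal_pos_iff]
  exact ⟨Metric.measure_ball_pos _ _ one_pos, measure_ball_lt_top⟩

/-- Set of pairs used in the Hardy inequality. -/
def hardySet : Set (E3 × E3) := {p | 512 * jap p.1 < ‖p.2‖ ∧ ‖p.2‖ ≤ 1024 * jap p.1}

lemma hardySet_meas : MeasurableSet hardySet := by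
  unfold hardySet
  have h1 : Measurable (fun p : E3 × E3 => jap p.1) :=
    (jap_continuous.comp continuous_fst).measurable
  have h2 : Measurable (fun p : E3 × E3 => ‖p.2‖) := continuous_snd.norm.measurable
  exact (measurableSet_lt (h1.const_mul _) h2).inter (measurableSet_le h2 (h1.const_mul _))

lemma hardy_F_integrable {s : ℝ} (hs0 : 0 < s) {G : E3 → ℝ}
    (hG : Continuous G) (hc : HasCompactSupport G) :
    Integrable (hardySet.indicator (fun p => jap p.1 ^ (-(2 * s) - 3) * G p.2 ^ 2))
      ((volume : Measure E3).prod volume) := by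
  obtain ⟨ρ, hρ⟩ := hc.isBounded.subset_closedBall (0 : E3)
  have h1 : Integrable ((Metric.closedBall (0:E3) ρ).indicator (fun _ => (1:ℝ)))
      (volume : Measure E3) := by
    rw [integrable_indicator_iff measurableSet_closedBall]
    exact integrableOn_const measure_closedBall_lt_top.ne
  have h2 : Integrable (fun w => G w ^ 2) (volume : Measure E3) := by
    have hcc : HasCompactSupport (fun w => G w ^ 2) :=
      hc.comp_left (g := fun x : ℝ => x ^ 2) (by simp)
    exact Continuous.integrable_of_hasCompactSupport (hG.pow 2) hcc
  refine (h1.mul_prod h2).mono' ?_ ?_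
  · apply Measurable.aestronglyMeasurable
    apply Measurable.indicator _ hardySet_meas
    exact ((jap_continuous.comp continuous_fst).measurable.pow_const _).mul
      ((hG.comp continuous_snd).pow 2).measurable
  · refine Filter.Eventually.of_forall ?_
    rintro ⟨v, w⟩
    simp only
    by_cases hS : (v, w) ∈ hardySet
    · rw [Set.indicator_of_mem hS]
      have hj := jap_one_le v
      have hjp := jap_pos v
      rw [Real.norm_of_nonneg (by positivity)]
      by_cases hw : G w = 0
      · simp [hw]
      · have hw' : w ∈ Metric.closedBall (0:E3) ρ := hρ (subset_tsupport _ hw)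
        rw [mem_closedBall_zero_iff] at hw'
        have hv : v ∈ Metric.closedBall (0:E3) ρ := by
          rw [mem_closedBall_zero_iff]
          have := hS.1
          simp only at this
          linarith [norm_le_jap v]
        rw [Set.indicator_of_mem hv]
        gcongr
        exact Real.rpow_le_one_of_one_le_of_nonpos hj (by linarith)
    · rw [Set.indicator_of_notMem hS, norm_zero]
      exact mul_nonneg (Set.indicator_nonneg (fun _ _ => zero_le_one) _) (sq_nonneg _)

lemma hardy_inner {s : ℝ} (hs0 : 0 < s) (hs1 : s < 1) (G : E3 → ℝ) (w : E3) :
    ∫ v : E3, hardySet.indicator (fun p => jap p.1 ^ (-(2 * s) - 3) * G p.2 ^ 2) (v, w)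
      ≤ 2 ^ 28 * (volume : Measure E3).real (Metric.ball 0 1) * (jap w ^ (-(2 * s)) * G w ^ 2) := by
  have hjw := jap_pos w
  set B := Metric.closedBall (0:E3) (jap w / 512)
  have hle : ∫ v : E3, hardySet.indicator (fun p => jap p.1 ^ (-(2 * s) - 3) * G p.2 ^ 2) (v, w)
      ≤ ∫ v : E3, B.indicator (fun _ => (jap w / 2048) ^ (-(2 * s) - 3) * G w ^ 2) v := by
    apply integral_mono_of_nonneg
    · refine Filter.Eventually.of_forall fun v => ?_
      refine Set.indicator_nonneg (fun p _ => ?_) _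
      have := jap_pos p.1
      positivity
    · rw [integrable_indicator_iff measurableSet_closedBall]
      exact integrableOn_const measure_closedBall_lt_top.ne
    · refine Filter.Eventually.of_forall fun v => ?_
      simp only
      have hjp := jap_pos v
      by_cases hS : (v, w) ∈ hardySet
      · have hS1 : 512 * jap v < ‖w‖ := hS.1
        have hS2 : ‖w‖ ≤ 1024 * jap v := hS.2
        have hj := jap_one_le v
        have hvB : v ∈ B := by
          rw [mem_closedBall_zero_iff]
          linarith [norm_le_jap v, norm_le_jap w]
        have hw2 : jap w ≤ 2 * ‖w‖ := by
          apply (sq_le_sq₀ hjw.le (by positivity)).1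
          rw [jap_sq]; nlinarith
        rw [Set.indicator_of_mem hS, Set.indicator_of_mem hvB]
        simp only
        apply mul_le_mul_of_nonneg_right _ (sq_nonneg _)
        apply Real.rpow_le_rpow_of_nonpos (by positivity) (by linarith) (by linarith)
      · rw [Set.indicator_of_notMem hS]
        exact Set.indicator_nonneg (fun _ _ => by positivity) _
  refine hle.trans ?_
  rw [integral_indicator measurableSet_closedBall, setIntegral_const, vol_real_closedBall _ (by positivity),
    smul_eq_mul]
  have hc := vol_unit_pos
  set c := (volume : Measure E3).real (Metric.ball 0 1)
  have e : (jap w / 512) ^ 3 * (jap w / 2048) ^ (-(2 * s) - 3) = 64 * 2048 ^ (2 * s) * jap w ^ (-(2*s)) := by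
    rw [Real.rpow_sub (by positivity), Real.div_rpow hjw.le (by norm_num), Real.rpow_neg (x := 2048) (by norm_num)]
    have : (jap w / 2048) ^ (3:ℝ) = (jap w / 2048) ^ 3 := by
      rw [← Real.rpow_natCast]; norm_num
    rw [this]
    field_simp
    norm_num
  have h2 : (2048:ℝ) ^ (2 * s) ≤ 2 ^ 22 := by
    calc (2048:ℝ) ^ (2 * s) ≤ 2048 ^ (2:ℝ) := by
          apply Real.rpow_le_rpow_of_exponent_le (by norm_num) (by linarith)
      _ = 2 ^ 22 := by norm_num
  calc _ = ((jap w / 512) ^ 3 * (jap w / 2048) ^ (-(2 * s) - 3)) * (c * G w ^ 2) := by ring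
    _ = (64 * 2048 ^ (2 * s) * jap w ^ (-(2*s))) * (c * G w ^ 2) := by rw [e]
    _ ≤ (64 * 2 ^ 22 * jap w ^ (-(2*s))) * (c * G w ^ 2) := by gcongr
    _ = _ := by ring

lemma hardy_pointwise {s : ℝ} (hs0 : 0 < s) {G : E3 → ℝ} (v : E3)
    (h1 : Integrable (fun w => (G v - G w) ^ 2 / ‖v - w‖ ^ (3 + 2 * s)))
    (h2 : Integrable (fun w =>
      hardySet.indicator (fun p => jap p.1 ^ (-(2 * s) - 3) * G p.2 ^ 2) (v, w))) :
    7 * 2 ^ 27 * (volume : Measure E3).real (Metric.ball 0 1) * (jap v ^ (-(2 * s)) * G v ^ 2)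
      ≤ 2 * 1536 ^ (3 + 2 * s) * gagD s G v + 2 * ∫ w : E3,
        hardySet.indicator (fun p => jap p.1 ^ (-(2 * s) - 3) * G p.2 ^ 2) (v, w) := by
  have hj := jap_pos v
  have hj1 := jap_one_le v
  set A : Set E3 := Metric.closedBall 0 (1024 * jap v) \ Metric.closedBall 0 (512 * jap v)
  have hAm : MeasurableSet A := measurableSet_closedBall.diff measurableSet_closedBall
  have hA : ∀ w, w ∈ A ↔ (v, w) ∈ hardySet := by
    intro w
    simp only [A, hardySet, Set.mem_sdiff, mem_closedBall_zero_iff, Set.mem_ofPred_eq, not_le]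
    exact and_comm
  have hvol : (volume : Measure E3).real A
      = 7 * 2 ^ 27 * jap v ^ 3 * (volume : Measure E3).real (Metric.ball 0 1) := by
    rw [measureReal_sdiff (Metric.closedBall_subset_closedBall (by linarith)) measurableSet_closedBall
      measure_closedBall_lt_top.ne, vol_real_closedBall _ (by positivity),
      vol_real_closedBall _ (by positivity)]
    ring
  have hL : ∫ w : E3, A.indicator (fun _ => jap v ^ (-(2 * s) - 3) * G v ^ 2) w
      = 7 * 2 ^ 27 * (volume : Measure E3).real (Metric.ball 0 1) * (jap v ^ (-(2 * s)) * G v ^ 2) := by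
    rw [integral_indicator hAm, setIntegral_const, hvol, smul_eq_mul, Real.rpow_sub hj]
    have : jap v ^ (3:ℝ) = jap v ^ 3 := by
      rw [← Real.rpow_natCast]; norm_num
    rw [this]
    field_simp
  rw [← hL, gagD, ← integral_const_mul, ← integral_const_mul, ← integral_add (h1.const_mul _) (h2.const_mul _)]
  apply integral_mono_of_nonneg
  · refine Filter.Eventually.of_forall fun w => ?_
    exact Set.indicator_nonneg (fun _ _ => by positivity) _
  · exact (h1.const_mul _).add (h2.const_mul _)
  · refine Filter.Eventually.of_forall fun w => ?_
    simp only
    by_cases hw : w ∈ A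
    · have hS := (hA w).1 hw
      have hS1 : 512 * jap v < ‖w‖ := hS.1
      have hS2 : ‖w‖ ≤ 1024 * jap v := hS.2
      rw [Set.indicator_of_mem hw, Set.indicator_of_mem hS]
      simp only
      have hnv := norm_le_jap v
      have hd : ‖v - w‖ ≤ 1536 * jap v := by
        have := norm_sub_le v w
        linarith
      have hd0 : 0 < ‖v - w‖ := by
        have := norm_sub_norm_le w v
        rw [norm_sub_rev] at this
        linarith
      have hpw : ‖v - w‖ ^ (3 + 2 * s) ≤ 1536 ^ (3 + 2 * s) * jap v ^ (3 + 2 * s) := by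
        rw [← Real.mul_rpow (by norm_num) hj.le]
        exact Real.rpow_le_rpow hd0.le hd (by linarith)
      have hinv : jap v ^ (-(2 * s) - 3) * jap v ^ (3 + 2 * s) = 1 := by
        rw [← Real.rpow_add hj]; ring_nf; simp
      have hk : jap v ^ (-(2 * s) - 3) * (G v - G w) ^ 2
          ≤ 1536 ^ (3 + 2 * s) * ((G v - G w) ^ 2 / ‖v - w‖ ^ (3 + 2 * s)) := by
        rw [← mul_div_assoc, le_div_iff₀ (by positivity)]
        calc _ ≤ jap v ^ (-(2 * s) - 3) * (G v - G w) ^ 2 * (1536 ^ (3 + 2 * s) * jap v ^ (3 + 2 * s)) := by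
              gcongr
          _ = (jap v ^ (-(2 * s) - 3) * jap v ^ (3 + 2 * s)) * (1536 ^ (3 + 2 * s) * (G v - G w) ^ 2) := by ring
          _ = _ := by rw [hinv, one_mul]
      have hpos : 0 < jap v ^ (-(2 * s) - 3) := by positivity
      have hsq : G v ^ 2 ≤ 2 * (G v - G w) ^ 2 + 2 * G w ^ 2 := by
        nlinarith [sq_nonneg (G v - 2 * G w)]
      have := mul_le_mul_of_nonneg_left hsq hpos.le
      linarith
    · rw [Set.indicator_of_notMem hw, Set.indicator_of_notMem (fun h => hw ((hA w).2 h))]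
      positivity

lemma sq_weight_integrable (p : ℝ) {G : E3 → ℝ} (hG : Continuous G) (hc : HasCompactSupport G) :
    Integrable (fun w => jap w ^ p * G w ^ 2) (volume : Measure E3) := by
  apply Continuous.integrable_of_hasCompactSupport
  · exact (jap_rpow_contDiff p).continuous.mul (hG.pow 2)
  · exact (hc.comp_left (g := fun x : ℝ => x ^ 2) (by simp)).mul_left

lemma hardy {s : ℝ} (hs0 : 0 < s) (hs1 : s < 1) : ∃ C > 0, ∀ G : E3 → ℝ,
    ContDiff ℝ (⊤ : ℕ∞) G → HasCompactSupport G →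
    ∫ v : E3, jap v ^ (-(2 * s)) * G v ^ 2 ≤ C * gagSq s G := by
  have hcp := vol_unit_pos
  set c := (volume : Measure E3).real (Metric.ball 0 1) with hcdef
  refine ⟨2 * 1536 ^ (3 + 2 * s) / (3 * 2 ^ 27 * c), by positivity, fun G hG hc => ?_⟩
  have hk := kernel_integrable hs0 hs1 hG hc
  have hF := hardy_F_integrable hs0 hG.continuous hc
  have hI := sq_weight_integrable (-(2 * s)) hG.continuous hc
  have hD : Integrable (gagD s G) := hk.integral_prod_left
  have hT := hF.integral_prod_left
  have step1 : 7 * 2 ^ 27 * c * ∫ v : E3, jap v ^ (-(2 * s)) * G v ^ 2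
      ≤ 2 * 1536 ^ (3 + 2 * s) * gagSq s G + 2 * ∫ v : E3, ∫ w : E3,
        hardySet.indicator (fun p => jap p.1 ^ (-(2 * s) - 3) * G p.2 ^ 2) (v, w) := by
    have : gagSq s G = ∫ v, gagD s G v := rfl
    rw [this, ← integral_const_mul, ← integral_const_mul, ← integral_const_mul,
      ← integral_add (hD.const_mul _) (hT.const_mul _)]
    apply integral_mono_ae (hI.const_mul _) ((hD.const_mul _).add (hT.const_mul _))
    filter_upwards [hk.prod_right_ae, hF.prod_right_ae] with v h1 h2
    exact hardy_pointwise hs0 v h1 h2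
  have step2 : ∫ v : E3, ∫ w : E3,
        hardySet.indicator (fun p => jap p.1 ^ (-(2 * s) - 3) * G p.2 ^ 2) (v, w)
      ≤ 2 ^ 28 * c * ∫ v : E3, jap v ^ (-(2 * s)) * G v ^ 2 := by
    have hsw := integral_integral_swap (f := fun v w => hardySet.indicator
      (fun p => jap p.1 ^ (-(2 * s) - 3) * G p.2 ^ 2) (v, w)) (μ := (volume : Measure E3))
      (ν := (volume : Measure E3)) hF
    rw [hsw, ← integral_const_mul]
    apply integral_mono hF.integral_prod_right (hI.const_mul _)
    intro w
    exact hardy_inner hs0 hs1 G w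
  rw [div_mul_eq_mul_div, le_div_iff₀ (by positivity)]
  linarith

lemma cs_ball (v : E3) {r : ℝ} (hr : 0 < r) {k : E3 → ℝ} (hk : Continuous k) :
    (∫ w in Metric.closedBall v r, |k w|) ^ 2
      ≤ r ^ 3 * (volume : Measure E3).real (Metric.ball 0 1)
        * ∫ w in Metric.closedBall v r, k w ^ 2 := by
  have hV : 0 < r ^ 3 * (volume : Measure E3).real (Metric.ball 0 1) :=
    mul_pos (by positivity) vol_unit_pos
  have hvol := vol_real_closedBall v hr.le
  set V := r ^ 3 * (volume : Measure E3).real (Metric.ball 0 1) with hVdef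
  have hcomp := isCompact_closedBall v r
  have i1 : IntegrableOn (fun w => |k w|) (Metric.closedBall v r) :=
    hk.abs.continuousOn.integrableOn_compact hcomp
  have i2 : IntegrableOn (fun w => k w ^ 2) (Metric.closedBall v r) :=
    (hk.pow 2).continuousOn.integrableOn_compact hcomp
  have ic : IntegrableOn (fun _ : E3 => ((∫ w in Metric.closedBall v r, |k w|) / V) ^ 2)
      (Metric.closedBall v r) := integrableOn_const measure_closedBall_lt_top.ne
  set I := ∫ w in Metric.closedBall v r, |k w| with hI
  set t := I / V with ht
  have h0 : 0 ≤ ∫ w in Metric.closedBall v r, ((k w ^ 2 - 2 * t * |k w|) + t ^ 2) := by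
    apply integral_nonneg
    intro w
    simp only [Pi.zero_apply]
    rw [← sq_abs (k w)]
    nlinarith [sq_nonneg (|k w| - t)]
  have i12 : IntegrableOn (fun w => k w ^ 2 - 2 * t * |k w|) (Metric.closedBall v r) :=
    i2.sub (i1.const_mul _)
  rw [integral_add i12 ic, integral_sub i2 (i1.const_mul _),
    integral_const_mul, setIntegral_const, hvol, smul_eq_mul, ← hI] at h0
  have e : 2 * t * I = 2 * I ^ 2 / V := by rw [ht]; ring
  have e2 : V * t ^ 2 = I ^ 2 / V := by rw [ht]; field_simp
  rw [e, e2] at h0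
  have : I ^ 2 / V ≤ ∫ w in Metric.closedBall v r, k w ^ 2 := by
    have : 2 * I ^ 2 / V = 2 * (I ^ 2 / V) := by ring
    linarith
  rw [div_le_iff₀ hV] at this
  linarith

lemma local_gradient : ∃ C > 0, ∀ f : E3 → ℝ, ContDiff ℝ (⊤ : ℕ∞) f →
    ∀ (v : E3) (r : ℝ), 0 < r → ∀ j : Fin 3,
    r ^ 5 * pd f j v ^ 2 ≤ C * (r ^ 2 * (∫ w in Metric.closedBall v r, (pd f j v - pd f j w) ^ 2)
      + ∫ w in Metric.closedBall v r, (f v - f w) ^ 2) := by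
  let φ : ContDiffBump (0 : E3) := ⟨1/2, 1, by norm_num, by norm_num⟩
  have hφs : ContDiff ℝ (⊤ : ℕ∞) φ := φ.contDiff
  have hφc : HasCompactSupport φ := φ.hasCompactSupport
  obtain ⟨M, hM⟩ := (hφc.fderiv (𝕜 := ℝ)).exists_bound_of_continuous
    (hφs.continuous_fderiv (by simp))
  have hM0 : 0 ≤ M := (norm_nonneg _).trans (hM 0)
  have hc0 : 0 < ∫ z, φ z := φ.integral_pos
  set c0 := ∫ z, φ z with hc0def
  have hcp := vol_unit_pos
  set c := (volume : Measure E3).real (Metric.ball 0 1) with hcdef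
  refine ⟨2 * c * (1 + M ^ 2) / c0 ^ 2, by positivity, fun f hf v r hr j => ?_⟩
  set e : E3 := EuclideanSpace.single j 1 with he
  have hen : ‖e‖ = 1 := by simp [he]
  set B := Metric.closedBall v r with hB
  let ψ : E3 → ℝ := fun w => φ (r⁻¹ • (w - v))
  have haff : ContDiff ℝ (⊤ : ℕ∞) (fun w : E3 => r⁻¹ • (w - v)) := by fun_prop
  have hψs : ContDiff ℝ (⊤ : ℕ∞) ψ := hφs.comp haff
  have hψ0 : ∀ w, w ∉ B → ψ w = 0 := by
    intro w hw
    apply φ.zero_of_le_dist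
    rw [hB, Metric.mem_closedBall, not_le, dist_eq_norm] at hw
    rw [dist_zero_right, norm_smul, norm_inv, Real.norm_of_nonneg hr.le]
    change (1:ℝ) ≤ _
    rw [← div_eq_inv_mul, le_div_iff₀ hr]
    linarith
  have hψts : tsupport ψ ⊆ B := by
    apply closure_minimal _ Metric.isClosed_closedBall
    intro w hw
    by_contra h
    exact hw (hψ0 w h)
  have hψc : HasCompactSupport ψ := HasCompactSupport.of_support_subset_isCompact
    (isCompact_closedBall v r) ((subset_tsupport _).trans hψts)
  have hψint : ∫ w, ψ w = r ^ 3 * c0 := by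
    have h1 : ∫ w, ψ w = ∫ w, φ (r⁻¹ • w) :=
      integral_sub_right_eq_self (fun w => φ (r⁻¹ • w)) v
    rw [h1, Measure.integral_comp_smul]
    simp [abs_of_pos hr, hc0def]
  have hdψ : ∀ w, |fderiv ℝ ψ w e| ≤ M / r := by
    intro w
    have hd : HasFDerivAt ψ ((fderiv ℝ φ (r⁻¹ • (w - v))).comp
        (r⁻¹ • ContinuousLinearMap.id ℝ E3)) w := by
      have a1 : HasFDerivAt φ (fderiv ℝ φ (r⁻¹ • (w - v))) (r⁻¹ • (w - v)) :=
        (hφs.differentiable (by simp) _).hasFDerivAt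
      have a2 : HasFDerivAt (fun w : E3 => r⁻¹ • (w - v)) (r⁻¹ • ContinuousLinearMap.id ℝ E3) w :=
        ((hasFDerivAt_id w).sub_const v).const_smul r⁻¹
      exact HasFDerivAt.comp (g := (φ : E3 → ℝ)) (f := fun w : E3 => r⁻¹ • (w - v)) w a1 a2
    rw [hd.fderiv]
    simp only [ContinuousLinearMap.comp_apply, smul_apply,
      ContinuousLinearMap.id_apply, map_smul, smul_eq_mul, abs_mul]
    rw [abs_of_pos (inv_pos.2 hr), div_eq_inv_mul]
    gcongr
    have := (fderiv ℝ φ (r⁻¹ • (w - v))).le_opNorm e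
    rw [hen, mul_one, Real.norm_eq_abs] at this
    exact this.trans (hM _)
  have hdψ0 : ∀ w, w ∉ B → fderiv ℝ ψ w e = 0 := by
    intro w hw
    have : fderiv ℝ ψ w = 0 := by
      by_contra h
      exact hw (hψts (support_fderiv_subset ℝ h))
    rw [this]; simp
  have hgs : ContDiff ℝ (⊤ : ℕ∞) (fun w => f w - f v) := hf.sub contDiff_const
  have hpdc : Continuous (pd f j) := (pd_contDiff hf j).continuous
  have hfd : ∀ w, fderiv ℝ (fun w => f w - f v) w e = pd f j w := by
    intro w
    rw [fderiv_sub_const]; rfl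
  have hdψcont : Continuous (fun w => fderiv ℝ ψ w e) :=
    (hψs.continuous_fderiv (by simp)).clm_apply continuous_const
  have hdψc : HasCompactSupport (fun w => fderiv ℝ ψ w e) :=
    (hψc.fderiv (𝕜 := ℝ)).comp_left (g := fun L : E3 →L[ℝ] ℝ => L e) (by simp)
  have ibp := integral_mul_fderiv_eq_neg_fderiv_mul_of_integrable (μ := (volume : Measure E3))
    (f := ψ) (g := fun w => f w - f v) (v := e)
    ((hdψcont.mul hgs.continuous).integrable_of_hasCompactSupport hdψc.mul_right)
    (by
      simp only [hfd]
      exact (hψs.continuous.mul hpdc).integrable_of_hasCompactSupport hψc.mul_right)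
    ((hψs.continuous.mul hgs.continuous).integrable_of_hasCompactSupport hψc.mul_right)
    (fun x _ => hψs.differentiable (by simp) x) (fun x _ => hgs.differentiable (by simp) x)
  simp only [hfd] at ibp
  have iψ1 : Integrable (fun w => ψ w * (pd f j v - pd f j w)) (volume : Measure E3) :=
    (hψs.continuous.mul (continuous_const.sub hpdc)).integrable_of_hasCompactSupport hψc.mul_right
  have iψ2 : Integrable (fun w => ψ w * pd f j w) (volume : Measure E3) :=
    (hψs.continuous.mul hpdc).integrable_of_hasCompactSupport hψc.mul_right
  have iψ3 : Integrable (fun w => fderiv ℝ ψ w e * (f w - f v)) (volume : Measure E3) :=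
    (hdψcont.mul hgs.continuous).integrable_of_hasCompactSupport hdψc.mul_right
  have main : r ^ 3 * c0 * pd f j v = (∫ w, ψ w * (pd f j v - pd f j w))
      - ∫ w, fderiv ℝ ψ w e * (f w - f v) := by
    rw [← hψint, ← integral_mul_const, sub_eq_add_neg, ← ibp, ← integral_add iψ1 iψ2]
    congr 1
    ext w
    ring
  have hBc : IsCompact B := isCompact_closedBall v r
  have hBm : MeasurableSet B := measurableSet_closedBall
  have k1c : Continuous (fun w => pd f j v - pd f j w) := continuous_const.sub hpdc
  have k2c : Continuous (fun w => f v - f w) := continuous_const.sub hf.continuous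
  have b1 : |∫ w, ψ w * (pd f j v - pd f j w)| ≤ ∫ w in B, |pd f j v - pd f j w| := by
    rw [← integral_indicator hBm]
    refine (abs_integral_le_integral_abs).trans ?_
    apply integral_mono iψ1.abs
    · rw [integrable_indicator_iff hBm]
      exact k1c.abs.continuousOn.integrableOn_compact hBc
    · intro w
      by_cases hw : w ∈ B
      · simp only [Set.indicator_of_mem hw, abs_mul]
        have : |ψ w| ≤ 1 := by
          rw [abs_of_nonneg φ.nonneg]; exact φ.le_one
        calc _ ≤ 1 * |pd f j v - pd f j w| := by gcongr
          _ = _ := one_mul _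
      · simp [Set.indicator_of_notMem hw, hψ0 w hw]
  have b2 : |∫ w, fderiv ℝ ψ w e * (f w - f v)| ≤ M / r * ∫ w in B, |f v - f w| := by
    rw [← integral_indicator hBm, ← integral_const_mul]
    refine (abs_integral_le_integral_abs).trans ?_
    apply integral_mono iψ3.abs
    · apply Integrable.const_mul
      rw [integrable_indicator_iff hBm]
      exact k2c.abs.continuousOn.integrableOn_compact hBc
    · intro w
      by_cases hw : w ∈ B
      · simp only [Set.indicator_of_mem hw, abs_mul]
        rw [abs_sub_comm (f v)]
        gcongr
        exact hdψ w
      · simp [Set.indicator_of_notMem hw, hdψ0 w hw]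
  have s1 := cs_ball v hr k1c
  have s2 := cs_ball v hr k2c
  rw [← hB, ← hcdef] at s1 s2
  have n1 : 0 ≤ ∫ w in B, (pd f j v - pd f j w) ^ 2 := integral_nonneg fun _ => sq_nonneg _
  have n2 : 0 ≤ ∫ w in B, (f v - f w) ^ 2 := integral_nonneg fun _ => sq_nonneg _
  set X := ∫ w, ψ w * (pd f j v - pd f j w)
  set Y := ∫ w, fderiv ℝ ψ w e * (f w - f v)
  set I1 := ∫ w in B, |pd f j v - pd f j w|
  set I2 := ∫ w in B, |f v - f w|
  set J1 := ∫ w in B, (pd f j v - pd f j w) ^ 2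
  set J2 := ∫ w in B, (f v - f w) ^ 2
  have q1 : X ^ 2 ≤ r ^ 3 * c * J1 := by
    rw [← sq_abs]
    exact (pow_le_pow_left₀ (abs_nonneg _) b1 2).trans s1
  have q2 : r ^ 2 * Y ^ 2 ≤ M ^ 2 * (r ^ 3 * c * J2) := by
    have := pow_le_pow_left₀ (abs_nonneg _) b2 2
    rw [sq_abs] at this
    calc r ^ 2 * Y ^ 2 ≤ r ^ 2 * (M / r * I2) ^ 2 := by gcongr
      _ = M ^ 2 * I2 ^ 2 := by field_simp
      _ ≤ _ := by gcongr
  have q3 : (r ^ 3 * c0 * pd f j v) ^ 2 ≤ 2 * X ^ 2 + 2 * Y ^ 2 := by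
    rw [main]; nlinarith [sq_nonneg (X + Y)]
  have q4 : r ^ 3 * (r ^ 5 * pd f j v ^ 2 * c0 ^ 2)
      ≤ r ^ 3 * (2 * c * (1 + M ^ 2) * (r ^ 2 * J1 + J2)) := by
    calc r ^ 3 * (r ^ 5 * pd f j v ^ 2 * c0 ^ 2) = r ^ 2 * (r ^ 3 * c0 * pd f j v) ^ 2 := by ring
      _ ≤ r ^ 2 * (2 * X ^ 2 + 2 * Y ^ 2) := by gcongr
      _ = 2 * r ^ 2 * X ^ 2 + 2 * (r ^ 2 * Y ^ 2) := by ring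
      _ ≤ 2 * r ^ 2 * (r ^ 3 * c * J1) + 2 * (M ^ 2 * (r ^ 3 * c * J2)) := by gcongr
      _ ≤ 2 * r ^ 2 * (r ^ 3 * c * J1) + 2 * (M ^ 2 * (r ^ 3 * c * J2))
          + (2 * r ^ 2 * (r ^ 3 * c * J1) * M ^ 2 + 2 * (r ^ 3 * c * J2)) := by
          have : 0 ≤ 2 * r ^ 2 * (r ^ 3 * c * J1) * M ^ 2 + 2 * (r ^ 3 * c * J2) := by positivity
          linarith
      _ = _ := by ring
  have q5 := le_of_mul_le_mul_left q4 (by positivity)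
  rw [div_mul_eq_mul_div, le_div_iff₀ (by positivity)]
  exact q5

lemma weight_ball {s : ℝ} (hs0 : 0 < s) (hs1 : s < 1) (p : ℝ) : ∃ C > 0, ∀ F G : E3 → ℝ,
    Continuous G → (∀ w, F w = jap w ^ p * G w) → ∀ (v : E3) (r : ℝ), 0 < r → r ≤ jap v / 2 →
    Integrable (fun w => (G v - G w) ^ 2 / ‖v - w‖ ^ (3 + 2 * s)) →
    ∫ w in Metric.closedBall v r, (F v - F w) ^ 2
      ≤ C * (r ^ 3 * r ^ (2 * s) * (jap v ^ p) ^ 2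
        * (gagD s G v + jap v ^ (-(2 * s)) * G v ^ 2)) := by
  obtain ⟨K, hK, hw⟩ := weight_scalar p
  have hcp := vol_unit_pos
  set c := (volume : Measure E3).real (Metric.ball 0 1) with hcdef
  refine ⟨2 * K ^ 2 * (1 + c), by positivity, fun F G hG hF v r hr hrv hint => ?_⟩
  have hj := jap_pos v
  have hjp : 0 < jap v ^ p := by positivity
  set B := Metric.closedBall v r with hB
  have hDn : 0 ≤ gagD s G v := integral_nonneg fun w => by positivity
  have hpt : ∀ w ∈ B, (F v - F w) ^ 2 ≤ 2 * K ^ 2 * (jap v ^ p) ^ 2 *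
      (r ^ 3 * r ^ (2 * s)) * ((G v - G w) ^ 2 / ‖v - w‖ ^ (3 + 2 * s))
      + 2 * K ^ 2 * (jap v ^ p) ^ 2 * (r ^ (2 * s) * jap v ^ (-(2 * s)) * G v ^ 2) := by
    intro w hwB
    have hd : ‖v - w‖ ≤ r := by
      rw [hB, Metric.mem_closedBall, dist_eq_norm, norm_sub_rev] at hwB; exact hwB
    have hjj : |jap w - jap v| ≤ ‖v - w‖ := by rw [abs_sub_comm]; exact jap_sub_le v w
    obtain ⟨w1, w2⟩ := hw (jap v) (jap w) hj (by linarith)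
    have hjw := jap_pos w
    have hwp : 0 < jap w ^ p := by positivity
    have hx0 : 0 < r / jap v := by positivity
    have hx1 : r / jap v ≤ 1 := by rw [div_le_one hj]; linarith
    have t1 : (jap w ^ p) ^ 2 ≤ K ^ 2 * (jap v ^ p) ^ 2 := by
      rw [← mul_pow]; gcongr
    have t2 : (jap w ^ p - jap v ^ p) ^ 2 ≤ K ^ 2 * (jap v ^ p) ^ 2 * (r ^ (2 * s) * jap v ^ (-(2 * s))) := by
      have h1 : |jap w ^ p - jap v ^ p| ≤ K * jap v ^ p * (r / jap v) := by
        refine w1.trans ?_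
        gcongr
        exact hjj.trans hd
      have h2 := pow_le_pow_left₀ (abs_nonneg _) h1 2
      rw [sq_abs, mul_pow, mul_pow] at h2
      refine h2.trans ?_
      gcongr
      rw [Real.rpow_neg hj.le, ← div_eq_mul_inv, ← Real.div_rpow hr.le hj.le, ← Real.rpow_natCast]
      apply Real.rpow_le_rpow_of_exponent_ge hx0 hx1
      push_cast; linarith
    have t3 : (G v - G w) ^ 2 ≤ (r ^ 3 * r ^ (2 * s)) * ((G v - G w) ^ 2 / ‖v - w‖ ^ (3 + 2 * s)) := by
      by_cases hvw : v = w
      · subst hvw; simp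
      · have hpos : 0 < ‖v - w‖ := norm_pos_iff.2 (sub_ne_zero.2 hvw)
        rw [← mul_div_assoc, le_div_iff₀ (by positivity), mul_comm]
        gcongr
        have : r ^ 3 * r ^ (2 * s) = r ^ (3 + 2 * s) := by
          rw [Real.rpow_add hr, ← Real.rpow_natCast]; norm_num
        rw [this]
        gcongr
    rw [hF v, hF w]
    set a := jap w ^ p
    set b := jap v ^ p
    calc (b * G v - a * G w) ^ 2 = (a * (G v - G w) - (a - b) * G v) ^ 2 := by ring
      _ ≤ 2 * (a ^ 2 * (G v - G w) ^ 2) + 2 * ((a - b) ^ 2 * G v ^ 2) := by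
          nlinarith [sq_nonneg (a * (G v - G w) + (a - b) * G v)]
      _ ≤ 2 * (K ^ 2 * b ^ 2 * ((r ^ 3 * r ^ (2 * s)) * ((G v - G w) ^ 2 / ‖v - w‖ ^ (3 + 2 * s))))
          + 2 * (K ^ 2 * b ^ 2 * (r ^ (2 * s) * jap v ^ (-(2 * s))) * G v ^ 2) := by
          gcongr
      _ = _ := by ring
  have hFc : Continuous F := by
    have : F = fun w => jap w ^ p * G w := funext hF
    rw [this]
    exact (jap_rpow_contDiff p).continuous.mul hG
  have ic : IntegrableOn (fun _ : E3 => 2 * K ^ 2 * (jap v ^ p) ^ 2 * (r ^ (2 * s) * jap v ^ (-(2 * s)) * G v ^ 2)) B :=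
    integrableOn_const measure_closedBall_lt_top.ne
  have ik : IntegrableOn (fun w => 2 * K ^ 2 * (jap v ^ p) ^ 2 *
      (r ^ 3 * r ^ (2 * s)) * ((G v - G w) ^ 2 / ‖v - w‖ ^ (3 + 2 * s))) B :=
    (hint.const_mul _).integrableOn
  have h1 := setIntegral_mono_on (μ := (volume : Measure E3))
    (((continuous_const.sub hFc).pow 2).continuousOn.integrableOn_compact
      (isCompact_closedBall v r)) (ik.add ic) measurableSet_closedBall hpt
  refine h1.trans ?_
  have e1 := integral_add ik ic
  simp only [Pi.add_apply] at e1 ⊢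
  rw [e1, integral_const_mul, setIntegral_const, vol_real_closedBall v hr.le, smul_eq_mul, ← hcdef]
  have h2 : ∫ w in B, (G v - G w) ^ 2 / ‖v - w‖ ^ (3 + 2 * s) ≤ gagD s G v :=
    setIntegral_le_integral hint (Filter.Eventually.of_forall fun w => by
      simp only [Pi.zero_apply]; positivity)
  set H := jap v ^ (-(2 * s)) * G v ^ 2 with hH
  have hHn : 0 ≤ H := by positivity
  set D := gagD s G v
  calc _ ≤ 2 * K ^ 2 * (jap v ^ p) ^ 2 * (r ^ 3 * r ^ (2 * s)) * D
        + r ^ 3 * c * (2 * K ^ 2 * (jap v ^ p) ^ 2 * (r ^ (2 * s) * jap v ^ (-(2 * s)) * G v ^ 2)) := by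
        gcongr
    _ = 2 * K ^ 2 * (jap v ^ p) ^ 2 * (r ^ 3 * r ^ (2 * s)) * (D + c * H) := by rw [hH]; ring
    _ ≤ 2 * K ^ 2 * (jap v ^ p) ^ 2 * (r ^ 3 * r ^ (2 * s)) * ((1 + c) * (D + H)) := by
        gcongr
        nlinarith [mul_nonneg hcp.le hDn]
    _ = _ := by ring

/-- Inner Gagliardo integral plus the Hardy weight term. -/
def gagQ (s : ℝ) (G : E3 → ℝ) (v : E3) : ℝ := gagD s G v + jap v ^ (-(2 * s)) * G v ^ 2

lemma gagD_nonneg (s : ℝ) (G : E3 → ℝ) (v : E3) : 0 ≤ gagD s G v :=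
  integral_nonneg fun w => by positivity

lemma gagSq_nonneg (s : ℝ) (G : E3 → ℝ) : 0 ≤ gagSq s G :=
  integral_nonneg fun v => gagD_nonneg s G v

lemma gagQ_nonneg (s : ℝ) (G : E3 → ℝ) (v : E3) : 0 ≤ gagQ s G v :=
  add_nonneg (gagD_nonneg s G v) (mul_nonneg (Real.rpow_nonneg (jap_pos v).le _) (sq_nonneg _))

lemma gagQ_integrable {s : ℝ} (hs0 : 0 < s) (hs1 : s < 1) {G : E3 → ℝ}
    (hG : ContDiff ℝ (⊤ : ℕ∞) G) (hc : HasCompactSupport G) : Integrable (gagQ s G) := by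
  have hD : Integrable (gagD s G) := (kernel_integrable hs0 hs1 hG hc).integral_prod_left
  exact hD.add (sq_weight_integrable (-(2 * s)) hG.continuous hc)

lemma gagQ_integral {s : ℝ} (hs0 : 0 < s) (hs1 : s < 1) : ∃ C > 0, ∀ G : E3 → ℝ,
    ContDiff ℝ (⊤ : ℕ∞) G → HasCompactSupport G → ∫ v, gagQ s G v ≤ C * gagSq s G := by
  obtain ⟨C, hC, h⟩ := hardy hs0 hs1
  refine ⟨1 + C, by positivity, fun G hG hc => ?_⟩
  have hD : Integrable (gagD s G) := (kernel_integrable hs0 hs1 hG hc).integral_prod_left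
  have e : ∫ v, gagQ s G v = (∫ v, gagD s G v) + ∫ v, jap v ^ (-(2 * s)) * G v ^ 2 :=
    integral_add hD (sq_weight_integrable (-(2 * s)) hG.continuous hc)
  have e2 : gagSq s G = ∫ v, gagD s G v := rfl
  have := h G hG hc
  rw [e, ← e2]
  linarith

lemma pointwise_bound {s : ℝ} (γ : ℝ) (hs0 : 0 < s) (hs1 : s < 1) : ∃ C > 0, ∀ f : E3 → ℝ,
    ContDiff ℝ (⊤ : ℕ∞) f → ∀ (j : Fin 3) (g h : E3 → ℝ),
    (g = fun v => jap v ^ (γ/2) * pd f j v) → (h = fun v => jap v ^ (-γ*(1-s)/(2*s)) * f v) →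
    ∀ v : E3, Integrable (fun w => (g v - g w) ^ 2 / ‖v - w‖ ^ (3 + 2 * s)) →
    Integrable (fun w => (h v - h w) ^ 2 / ‖v - w‖ ^ (3 + 2 * s)) →
    ∀ ρ : ℝ, 0 < ρ →
    pd f j v ^ 2 ≤ C * (ρ ^ (2 * s) * gagQ s g v + ρ ^ (2 * s - 2) * gagQ s h v) := by
  obtain ⟨C1, hC1, P⟩ := local_gradient
  obtain ⟨C2, hC2, W2⟩ := weight_ball hs0 hs1 (-(γ/2))
  obtain ⟨C3, hC3, W3⟩ := weight_ball hs0 hs1 (-(-γ*(1-s)/(2*s)))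
  refine ⟨C1 * (C2 + C3) + 4, by positivity, fun f hf j g h hg hh v ig ih ρ hρ => ?_⟩
  set a := -γ*(1-s)/(2*s) with ha
  have hj := jap_pos v
  have hcancel : ∀ (q x : ℝ) (w : E3), x = jap w ^ (-q) * (jap w ^ q * x) := by
    intro q x w
    rw [← mul_assoc, ← Real.rpow_add (jap_pos w)]; simp
  have hgF : ∀ w, pd f j w = jap w ^ (-(γ/2)) * g w := by
    intro w; rw [hg]; exact hcancel _ _ w
  have hhF : ∀ w, f w = jap w ^ (-a) * h w := by
    intro w; rw [hh]; exact hcancel _ _ w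
  have hgc : Continuous g := by
    rw [hg]; exact (jap_rpow_contDiff _).continuous.mul (pd_contDiff hf j).continuous
  have hhc : Continuous h := by
    rw [hh]; exact (jap_rpow_contDiff _).continuous.mul hf.continuous
  set r := ρ * jap v ^ (γ/(2*s)) with hrdef
  have hr : 0 < r := by positivity
  have hQg := gagQ_nonneg s g v
  have hQh := gagQ_nonneg s h v
  have id1 : r ^ (2 * s) * (jap v ^ (-(γ/2))) ^ 2 = ρ ^ (2 * s) := by
    rw [hrdef, Real.mul_rpow hρ.le (by positivity), ← Real.rpow_mul hj.le, ← Real.rpow_natCast,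
      ← Real.rpow_mul hj.le, mul_assoc, ← Real.rpow_add hj]
    have : γ / (2 * s) * (2 * s) + -(γ / 2) * ((2:ℕ):ℝ) = 0 := by
      field_simp; push_cast; ring
    rw [this, Real.rpow_zero, mul_one]
  have id2 : r ^ (2 * s) * (jap v ^ (-a)) ^ 2 = r ^ 2 * ρ ^ (2 * s - 2) := by
    have : r ^ (2 * s) = r ^ 2 * r ^ (2 * s - 2) := by
      rw [← Real.rpow_natCast, ← Real.rpow_add hr]; push_cast; ring_nf
    rw [this, mul_assoc]
    congr 1
    rw [hrdef, Real.mul_rpow hρ.le (by positivity), ← Real.rpow_mul hj.le, ← Real.rpow_natCast,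
      ← Real.rpow_mul hj.le, mul_assoc, ← Real.rpow_add hj]
    have : γ / (2 * s) * (2 * s - 2) + -a * ((2:ℕ):ℝ) = 0 := by
      rw [ha]; field_simp; push_cast; ring
    rw [this, Real.rpow_zero, mul_one]
  have hA : 0 ≤ ρ ^ (2 * s) * gagQ s g v := by positivity
  have hB : 0 ≤ ρ ^ (2 * s - 2) * gagQ s h v := by positivity
  rcases le_or_gt r (jap v / 2) with hle | hgt
  · have p := P f hf v r hr j
    have w2 := W2 (pd f j) g hgc hgF v r hr hle ig
    have w3 := W3 f h hhc hhF v r hr hle ih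
    have e2 : C2 * (r ^ 3 * r ^ (2 * s) * (jap v ^ (-(γ/2))) ^ 2
        * (gagD s g v + jap v ^ (-(2 * s)) * g v ^ 2)) = r ^ 3 * (C2 * (ρ ^ (2 * s) * gagQ s g v)) := by
      rw [← id1, gagQ]; ring
    have e3 : C3 * (r ^ 3 * r ^ (2 * s) * (jap v ^ (-a)) ^ 2
        * (gagD s h v + jap v ^ (-(2 * s)) * h v ^ 2))
        = r ^ 5 * (C3 * (ρ ^ (2 * s - 2) * gagQ s h v)) := by
      rw [mul_assoc (r ^ 3), id2, gagQ]; ring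
    rw [e2] at w2
    rw [e3] at w3
    have : r ^ 5 * pd f j v ^ 2 ≤ r ^ 5 * (C1 * (C2 * (ρ ^ (2 * s) * gagQ s g v)
        + C3 * (ρ ^ (2 * s - 2) * gagQ s h v))) := by
      refine p.trans ?_
      calc _ ≤ C1 * (r ^ 2 * (r ^ 3 * (C2 * (ρ ^ (2 * s) * gagQ s g v)))
            + r ^ 5 * (C3 * (ρ ^ (2 * s - 2) * gagQ s h v))) := by gcongr
        _ = _ := by ring
    have := le_of_mul_le_mul_left this (by positivity)
    refine this.trans ?_
    set X := ρ ^ (2 * s) * gagQ s g v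
    set Y := ρ ^ (2 * s - 2) * gagQ s h v
    have z1 : 0 ≤ C1 * C2 * Y := by positivity
    have z2 : 0 ≤ C1 * C3 * X := by positivity
    nlinarith
  · have h1 : pd f j v ^ 2 = (jap v ^ (-(γ/2))) ^ 2 * (jap v ^ (2 * s) * (jap v ^ (-(2 * s)) * g v ^ 2)) := by
      rw [← mul_assoc (jap v ^ (2 * s)), ← Real.rpow_add hj, hgF v]; simp; ring
    have h2 : jap v ^ (-(2 * s)) * g v ^ 2 ≤ gagQ s g v := by
      have := gagD_nonneg s g v
      unfold gagQ; linarith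
    have h3 : jap v ^ (2 * s) ≤ 4 * r ^ (2 * s) := by
      calc jap v ^ (2 * s) ≤ (2 * r) ^ (2 * s) := by
            apply Real.rpow_le_rpow hj.le (by linarith) (by linarith)
        _ = 2 ^ (2 * s) * r ^ (2 * s) := Real.mul_rpow (by norm_num) hr.le
        _ ≤ 2 ^ (2:ℝ) * r ^ (2 * s) := by
            gcongr
            · norm_num
            · linarith
        _ = _ := by norm_num
    have h4 : pd f j v ^ 2 ≤ 4 * (ρ ^ (2 * s) * gagQ s g v) := by
      rw [h1]
      calc _ ≤ (jap v ^ (-(γ/2))) ^ 2 * (4 * r ^ (2 * s) * gagQ s g v) := by gcongr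
        _ = 4 * ((r ^ (2 * s) * (jap v ^ (-(γ/2))) ^ 2) * gagQ s g v) := by ring
        _ = _ := by rw [id1]
    have z : 0 ≤ C1 * (C2 + C3) * (ρ ^ (2 * s) * gagQ s g v + ρ ^ (2 * s - 2) * gagQ s h v) := by
      positivity
    linarith

lemma integrated_bound {s : ℝ} (γ : ℝ) (hs0 : 0 < s) (hs1 : s < 1) : ∃ C > 0, ∀ f : E3 → ℝ,
    ContDiff ℝ (⊤ : ℕ∞) f → HasCompactSupport f → ∀ ρ : ℝ, 0 < ρ →
    (∫ v : E3, ∑ j : Fin 3, (pd f j v) ^ 2) ≤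
      C * (ρ ^ (2 * s) * ∑ j : Fin 3, gagSq s (fun v => jap v ^ (γ/2) * pd f j v)
        + ρ ^ (2 * s - 2) * gagSq s (fun v => jap v ^ (-γ*(1-s)/(2*s)) * f v)) := by
  obtain ⟨C, hC, P⟩ := pointwise_bound γ hs0 hs1
  obtain ⟨K, hK, Q⟩ := gagQ_integral hs0 hs1
  refine ⟨3 * C * K, by positivity, fun f hf hc ρ hρ => ?_⟩
  have hhs : ContDiff ℝ (⊤ : ℕ∞) (fun v => jap v ^ (-γ*(1-s)/(2*s)) * f v) :=
    (jap_rpow_contDiff _).mul hf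
  have hhc : HasCompactSupport (fun v => jap v ^ (-γ*(1-s)/(2*s)) * f v) := hc.mul_left
  have hgs : ∀ j, ContDiff ℝ (⊤ : ℕ∞) (fun v => jap v ^ (γ/2) * pd f j v) := fun j =>
    (jap_rpow_contDiff _).mul (pd_contDiff hf j)
  have hgc : ∀ j, HasCompactSupport (fun v => jap v ^ (γ/2) * pd f j v) := fun j =>
    (pd_hasCompactSupport hc j).mul_left
  have hpi : ∀ j, Integrable (fun v => pd f j v ^ 2) := by
    intro j
    have := sq_weight_integrable 0 (pd_contDiff hf j).continuous (pd_hasCompactSupport hc j)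
    simpa using this
  rw [integral_finsetSum _ (fun j _ => hpi j)]
  set h := fun v => jap v ^ (-γ*(1-s)/(2*s)) * f v with hh
  have hYn := gagSq_nonneg s h
  have hj : ∀ j : Fin 3, ∫ v, pd f j v ^ 2 ≤ C * K * (ρ ^ (2 * s) * gagSq s (fun v => jap v ^ (γ/2) * pd f j v)
      + ρ ^ (2 * s - 2) * gagSq s h) := by
    intro j
    set g := fun v => jap v ^ (γ/2) * pd f j v with hg
    have ig := gagQ_integrable hs0 hs1 (hgs j) (hgc j)
    have ih := gagQ_integrable hs0 hs1 hhs hhc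
    have step : ∫ v, pd f j v ^ 2 ≤ ∫ v, C * (ρ ^ (2 * s) * gagQ s g v + ρ ^ (2 * s - 2) * gagQ s h v) := by
      apply integral_mono_ae (hpi j) (((ig.const_mul _).add (ih.const_mul _)).const_mul _)
      filter_upwards [(kernel_integrable hs0 hs1 (hgs j) (hgc j)).prod_right_ae,
        (kernel_integrable hs0 hs1 hhs hhc).prod_right_ae] with v h1 h2
      exact P f hf j g h hg hh v h1 h2 ρ hρ
    refine step.trans ?_
    rw [integral_const_mul, integral_add (ig.const_mul _) (ih.const_mul _), integral_const_mul,
      integral_const_mul]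
    have q1 := Q g (hgs j) (hgc j)
    have q2 := Q h hhs hhc
    calc _ ≤ C * (ρ ^ (2 * s) * (K * gagSq s g) + ρ ^ (2 * s - 2) * (K * gagSq s h)) := by gcongr
      _ = _ := by ring
  calc _ ≤ ∑ j : Fin 3, C * K * (ρ ^ (2 * s) * gagSq s (fun v => jap v ^ (γ/2) * pd f j v)
      + ρ ^ (2 * s - 2) * gagSq s h) := Finset.sum_le_sum fun j _ => hj j
    _ = C * K * (ρ ^ (2 * s) * ∑ j : Fin 3, gagSq s (fun v => jap v ^ (γ/2) * pd f j v)
      + 3 * (ρ ^ (2 * s - 2) * gagSq s h)) := by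
        rw [← Finset.mul_sum, Finset.sum_add_distrib, ← Finset.mul_sum]
        simp
    _ ≤ _ := by
        have hXn : 0 ≤ ∑ j : Fin 3, gagSq s (fun v => jap v ^ (γ/2) * pd f j v) :=
          Finset.sum_nonneg fun j _ => gagSq_nonneg s _
        have z : 0 ≤ C * K * (ρ ^ (2 * s) * ∑ j : Fin 3, gagSq s (fun v => jap v ^ (γ/2) * pd f j v)) := by
          positivity
        nlinarith

lemma optimize {s N C X Y : ℝ} (hs0 : 0 < s) (hs1 : s < 1) (hX : 0 ≤ X) (hY : 0 ≤ Y)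
    (hC : 0 < C)
    (h : ∀ ρ : ℝ, 0 < ρ → N ≤ C * (ρ ^ (2 * s) * X + ρ ^ (2 * s - 2) * Y)) :
    N ≤ 2 * C * (Y ^ s * X ^ (1 - s)) := by
  have key : ∀ δ : ℝ, 0 < δ → N ≤ 2 * C * ((Y + δ) ^ s * (X + δ) ^ (1 - s)) := by
    intro δ hδ
    have hx : 0 < X + δ := by linarith
    have hy : 0 < Y + δ := by linarith
    have hq : 0 < (Y + δ) / (X + δ) := by positivity
    have := h (((Y + δ) / (X + δ)) ^ (1/2 : ℝ)) (by positivity)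
    rw [← Real.rpow_mul hq.le, ← Real.rpow_mul hq.le] at this
    have a1 : 1 / 2 * (2 * s) = s := by ring
    have a2 : 1 / 2 * (2 * s - 2) = s - 1 := by ring
    rw [a1, a2, Real.div_rpow hy.le hx.le, Real.div_rpow hy.le hx.le] at this
    have b1 : (Y + δ) ^ s / (X + δ) ^ s * (X + δ) = (Y + δ) ^ s * (X + δ) ^ (1 - s) := by
      rw [Real.rpow_sub hx, Real.rpow_one]; ring
    have b2 : (Y + δ) ^ (s - 1) / (X + δ) ^ (s - 1) * (Y + δ) = (Y + δ) ^ s * (X + δ) ^ (1 - s) := by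
      rw [Real.rpow_sub hy, Real.rpow_one, show (1 - s) = -(s - 1) by ring, Real.rpow_neg hx.le]
      field_simp
    refine this.trans ?_
    calc _ ≤ C * ((Y + δ) ^ s / (X + δ) ^ s * (X + δ)
          + (Y + δ) ^ (s - 1) / (X + δ) ^ (s - 1) * (Y + δ)) := by
          gcongr <;> linarith
      _ = _ := by rw [b1, b2]; ring
  have hcont : Continuous (fun δ : ℝ => 2 * C * ((Y + δ) ^ s * (X + δ) ^ (1 - s))) := by
    apply continuous_const.mul
    apply Continuous.mul
    · exact (continuous_const.add continuous_id).rpow_const (fun _ => Or.inr hs0.le)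
    · exact (continuous_const.add continuous_id).rpow_const (fun _ => Or.inr (by linarith))
  have ht := (hcont.tendsto 0).mono_left (nhdsWithin_le_nhds (s := Set.Ioi 0))
  simp only [add_zero] at ht
  refine ge_of_tendsto ht ?_
  filter_upwards [self_mem_nhdsWithin] with δ hδ
  exact key δ hδ

lemma final_aux
    (s γ κ : ℝ) (hs0 : 0 < s) (hs1 : s < 1) (hκ : κ = 1/(1+2*s)) :
    ∃ C > 0, ∀ ν : ℝ, 0 < ν → ν ≤ 1 → ∀ A₀ : ℝ, 1 ≤ A₀ →
      ∀ f : E3 → ℝ, ContDiff ℝ (⊤ : ℕ∞) f → HasCompactSupport f →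
      ν ^ (2*κ) * (∫ v : E3, ∑ j : Fin 3, (pd f j v) ^ 2) ≤
          C * A₀ ^ (-s) *
            (A₀ * ν ^ (1-κ) * gagSq s (fun v => jap v ^ (-γ*(1-s)/(2*s)) * f v)) ^ s *
            (ν ^ (1+κ) * ∑ j : Fin 3, gagSq s (fun v => jap v ^ (γ/2) * pd f j v)) ^ (1-s) ∧
        C * A₀ ^ (-s) *
            (A₀ * ν ^ (1-κ) * gagSq s (fun v => jap v ^ (-γ*(1-s)/(2*s)) * f v)) ^ s *
            (ν ^ (1+κ) * ∑ j : Fin 3, gagSq s (fun v => jap v ^ (γ/2) * pd f j v)) ^ (1-s) ≤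
          C * A₀ ^ (-s) *
            (A₀ * ν ^ (1-κ) * gagSq s (fun v => jap v ^ (-γ*(1-s)/(2*s)) * f v)
              + ν ^ (1+κ) * ∑ j : Fin 3, gagSq s (fun v => jap v ^ (γ/2) * pd f j v)) := by
  obtain ⟨C, hC, H⟩ := integrated_bound γ hs0 hs1
  refine ⟨2 * C, by positivity, fun ν hν _ A hA f hf hc => ?_⟩
  have hb := H f hf hc
  have hXn : 0 ≤ ∑ j : Fin 3, gagSq s (fun v => jap v ^ (γ/2) * pd f j v) :=
    Finset.sum_nonneg fun j _ => gagSq_nonneg s _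
  have hYn := gagSq_nonneg s (fun v => jap v ^ (-γ*(1-s)/(2*s)) * f v)
  set X := ∑ j : Fin 3, gagSq s (fun v => jap v ^ (γ/2) * pd f j v)
  set Y := gagSq s (fun v => jap v ^ (-γ*(1-s)/(2*s)) * f v)
  have hA0 : 0 < A := by linarith
  constructor
  · have ho := optimize hs0 hs1 hXn hYn hC hb
    have e : 2 * C * A ^ (-s) * (A * ν ^ (1-κ) * Y) ^ s * (ν ^ (1+κ) * X) ^ (1-s)
        = ν ^ (2*κ) * (2 * C * (Y ^ s * X ^ (1 - s))) := by
      rw [Real.mul_rpow (by positivity) hYn, Real.mul_rpow hA0.le (by positivity),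
        Real.mul_rpow (by positivity) hXn, ← Real.rpow_mul hν.le, ← Real.rpow_mul hν.le]
      have eA : A ^ (-s) * A ^ s = 1 := by rw [← Real.rpow_add hA0]; simp
      have eν : ν ^ ((1-κ) * s) * ν ^ ((1+κ) * (1-s)) = ν ^ (2*κ) := by
        rw [← Real.rpow_add hν]
        congr 1
        have : 1 + 2 * s ≠ 0 := by positivity
        rw [hκ]; field_simp; ring
      calc _ = (A ^ (-s) * A ^ s) * (ν ^ ((1-κ) * s) * ν ^ ((1+κ) * (1-s)))
            * (2 * C * (Y ^ s * X ^ (1 - s))) := by ring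
        _ = _ := by rw [eA, eν, one_mul]
    rw [e]
    gcongr
  · have hP : 0 ≤ A * ν ^ (1-κ) * Y := by positivity
    have hQ : 0 ≤ ν ^ (1+κ) * X := by positivity
    have := Real.geom_mean_le_arith_mean2_weighted hs0.le (by linarith : 0 ≤ 1 - s) hP hQ (by ring)
    rw [mul_assoc]
    gcongr
    refine this.trans ?_
    nlinarith

/-- **ν-weighted gradient control by fractional dissipation.**  Let `0 < s < 1`,
`max{−3, −3/2 − 2s} < γ < −2s`, and `κ = 1/(1+2s)` (so that
`s(1−κ) + (1−s)(1+κ) = 2κ`).  There is `C = C(s,γ) > 0` such that for every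
`ν ∈ (0,1]`, `A₀ ≥ 1` and `f ∈ C_c^∞(ℝ³;ℝ)`,
`ν^{2κ} ‖∇_v f‖²_{L²} ≤ C A₀^{−s} (A₀ ν^{1−κ} [⟨v⟩^{−γ(1−s)/(2s)} f]²_{Ḣ^s})^s
  (ν^{1+κ} [⟨v⟩^{γ/2} ∇_v f]²_{Ḣ^s})^{1−s}
  ≤ C A₀^{−s} (A₀ ν^{1−κ} [⟨v⟩^{−γ(1−s)/(2s)} f]²_{Ḣ^s}
  + ν^{1+κ} [⟨v⟩^{γ/2} ∇_v f]²_{Ḣ^s})`,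
where the seminorm of the gradient is the ℓ² sum of those of its components. -/
theorem nu_weighted_gradient_control
    (s γ κ : ℝ) (hs0 : 0 < s) (hs1 : s < 1)
    (hγ1 : max (-3) (-3/2 - 2*s) < γ) (hγ2 : γ < -2*s) (hκ : κ = 1/(1+2*s)) :
    ∃ C > 0, ∀ ν : ℝ, 0 < ν → ν ≤ 1 → ∀ A₀ : ℝ, 1 ≤ A₀ →
      ∀ f : E3 → ℝ, ContDiff ℝ (⊤ : ℕ∞) f → HasCompactSupport f →
      ν ^ (2*κ) * (∫ v : E3, ∑ j : Fin 3, (pd f j v) ^ 2) ≤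
          C * A₀ ^ (-s) *
            (A₀ * ν ^ (1-κ) * gagSq s (fun v => jap v ^ (-γ*(1-s)/(2*s)) * f v)) ^ s *
            (ν ^ (1+κ) * ∑ j : Fin 3, gagSq s (fun v => jap v ^ (γ/2) * pd f j v)) ^ (1-s) ∧
        C * A₀ ^ (-s) *
            (A₀ * ν ^ (1-κ) * gagSq s (fun v => jap v ^ (-γ*(1-s)/(2*s)) * f v)) ^ s *
            (ν ^ (1+κ) * ∑ j : Fin 3, gagSq s (fun v => jap v ^ (γ/2) * pd f j v)) ^ (1-s) ≤
          C * A₀ ^ (-s) *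
            (A₀ * ν ^ (1-κ) * gagSq s (fun v => jap v ^ (-γ*(1-s)/(2*s)) * f v)
              + ν ^ (1+κ) * ∑ j : Fin 3, gagSq s (fun v => jap v ^ (γ/2) * pd f j v)) := by
  exact final_aux s γ κ hs0 hs1 hκ
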